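/- Let n ≥ 3 be an integer with n ≡ 9 (mod 15). Then there is no lattice tiling of ℤⁿ by the error ball B(n,2,1,1). -/

import Mathlib

/-- The error ball `B(n,2,1,1)`: vectors in `ℤⁿ` with entries in `{-1,0,1}`
and at most `2` nonzero coordinates. -/
def errBall (n : ℕ) : Set (Fin n → ℤ) :=
  {a | (∀ i, a i = -1 ∨ a i = 0 ∨ a i = 1) ∧
    (Finset.univ.filter (fun i => a i ≠ 0)).card ≤ 2}

/-- A lattice tiling of `ℤⁿ` by `V`: a subgroup `L` such that every `x ∈ ℤⁿ`
is uniquely `v + l` with `v ∈ V`, `l ∈ L`. -/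
def IsLatticeTiling (n : ℕ) (V : Set (Fin n → ℤ)) (L : AddSubgroup (Fin n → ℤ)) : Prop :=
  ∀ x : Fin n → ℤ, ∃! p : (Fin n → ℤ) × (Fin n → ℤ),
    p.1 ∈ V ∧ p.2 ∈ L ∧ x = p.1 + p.2


structure NiceSet (n : ℕ) (G : Type) [AddCommGroup G] [Fintype G] [DecidableEq G]
    (A : Finset G) : Prop where
  zero : (0 : G) ∈ A
  neg : ∀ a ∈ A, -a ∈ A
  card : A.card = 2 * n + 1
  star : ∀ (M : Type) [AddCommGroup M] (f : G → M),
    ∑ a ∈ A, ∑ b ∈ A, f (a + b) =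
      (2 : ℤ) • ∑ g, f g + ∑ a ∈ A, f ((2 : ℕ) • a) + (2 * (n : ℤ) - 2) • f 0

theorem NiceSet.cardG {n : ℕ} {G : Type} [AddCommGroup G] [Fintype G] [DecidableEq G]
    {A : Finset G} (h : NiceSet n G A) : (Fintype.card G : ℤ) = 2 * (n : ℤ) ^ 2 + 1 := by
  have := h.star ℤ (fun _ => 1)
  simp [h.card] at this
  nlinarith


theorem nine_pow : ∀ p : Fin 18, (38 - 2 ^ (p.val + 1) : ZMod 163) ≠ 0 := by decide

theorem nine_aux (A : Finset (ZMod 163)) (h : NiceSet 9 (ZMod 163) A) : False := by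
  have : Fact (Nat.Prime 163) := ⟨by norm_num⟩
  have hM : ∀ m : ℕ, 1 ≤ m → m ≤ 18 → ∑ a ∈ A, a ^ m = 0 := by
    intro m
    induction m using Nat.strong_induction_on with
    | _ m ih =>
    intro h1 h2
    have hs := h.star (ZMod 163) (fun x => x ^ m)
    have h0 : ∑ x : ZMod 163, x ^ m = 0 := by
      apply FiniteField.sum_pow_lt_card_sub_one
      simp [ZMod.card]; omega
    have hexp : ∑ a ∈ A, ∑ b ∈ A, (a + b) ^ m
        = ∑ k ∈ Finset.range (m + 1),
          (∑ a ∈ A, a ^ k) * (∑ b ∈ A, b ^ (m - k)) * (m.choose k : ZMod 163) := by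
      simp_rw [add_pow, Finset.sum_mul_sum, Finset.sum_mul]
      rw [Finset.sum_comm]
      refine (Finset.sum_congr rfl fun b _ => Finset.sum_comm).trans ?_
      rw [Finset.sum_comm]
      exact Finset.sum_congr rfl fun b _ => Finset.sum_comm
    have hz : (∑ a ∈ A, a ^ 0) = (19 : ZMod 163) := by
      simp [h.card]
    obtain ⟨p, rfl⟩ : ∃ p, m = p + 1 := ⟨m - 1, by omega⟩
    have hzero : ∑ k ∈ Finset.range p, (∑ a ∈ A, a ^ (k + 1)) * (∑ b ∈ A, b ^ (p + 1 - (k + 1)))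
        * ((p + 1).choose (k + 1) : ZMod 163) = 0 := by
      apply Finset.sum_eq_zero
      intro k hk
      rw [Finset.mem_range] at hk
      rw [ih (k + 1) (by omega) (by omega) (by omega)]
      simp
    rw [Finset.sum_range_succ, Finset.sum_range_succ', hzero] at hexp
    · simp only [zero_add, Nat.choose_zero_right, Nat.choose_self, Nat.sub_zero, Nat.sub_self, hz]
        at hexp
      rw [hexp, h0] at hs
      simp only [smul_zero, zero_add, nsmul_eq_mul, mul_pow, ← Finset.mul_sum, Nat.cast_one,
        mul_one, Nat.cast_ofNat, zero_pow (Nat.succ_ne_zero p), add_zero] at hs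
      have h3 : (38 - 2 ^ (p + 1) : ZMod 163) * ∑ a ∈ A, a ^ (p + 1) = 0 := by
        linear_combination hs
      rcases mul_eq_zero.1 h3 with h4 | h4
      · exfalso
        exact nine_pow ⟨p, by omega⟩ h4
      · exact h4
  have hcard := h.card
  obtain ⟨a, ha, ha0⟩ : ∃ a ∈ A, a ≠ 0 := by
    by_contra hc
    push Not at hc
    have : A ⊆ {0} := fun x hx => by simp [hc x hx]
    have := Finset.card_le_card this
    simp at this; omega
  let S := (A.erase 0).erase a
  have hScard : S.card = 17 := by
    rw [Finset.card_erase_of_mem (by simp [ha, ha0]), Finset.card_erase_of_mem h.zero]; omega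
  let P : Polynomial (ZMod 163) := Polynomial.X * ∏ b ∈ S, (Polynomial.X - Polynomial.C b)
  have hdeg : P.natDegree ≤ 18 := by
    refine Polynomial.natDegree_mul_le.trans ?_
    rw [Polynomial.natDegree_prod_of_monic _ _ fun b _ => Polynomial.monic_X_sub_C b]
    simp [hScard]
  have hsum : ∑ x ∈ A, P.eval x = 0 := by
    simp_rw [Polynomial.eval_eq_sum_range' (Nat.lt_succ_of_le hdeg)]
    rw [Finset.sum_comm]
    apply Finset.sum_eq_zero
    intro k hk
    rw [Finset.mem_range] at hk
    rw [← Finset.mul_sum]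
    rcases Nat.eq_zero_or_pos k with rfl | hk0
    · simp [P]
    · rw [hM k hk0 (by omega), mul_zero]
  rw [Finset.sum_eq_single_of_mem a ha] at hsum
  · simp only [P, Polynomial.eval_mul, Polynomial.eval_X, Polynomial.eval_prod,
      Polynomial.eval_sub, Polynomial.eval_C] at hsum
    rcases mul_eq_zero.1 hsum with h1 | h1
    · exact ha0 h1
    · rw [Finset.prod_eq_zero_iff] at h1
      obtain ⟨b, hb, hab⟩ := h1
      rw [sub_eq_zero] at hab
      simp [S, ← hab] at hb
  · intro b hb hba
    by_cases hb0 : b = 0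
    · simp [P, hb0]
    · simp only [P, Polynomial.eval_mul, Polynomial.eval_X, Polynomial.eval_prod,
        Polynomial.eval_sub, Polynomial.eval_C]
      rw [Finset.prod_eq_zero (i := b) (by simp [S, hb, hba, hb0]) (by simp), mul_zero]

theorem nine_case (G : Type) [AddCommGroup G] [Fintype G] [DecidableEq G] (A : Finset G)
    (h : NiceSet 9 G A) : False := by
  have hc : Nat.card G = 163 := by
    have := h.cardG
    rw [Nat.card_eq_fintype_card]; norm_num at this; exact_mod_cast this
  have : Fact (Nat.Prime 163) := ⟨by norm_num⟩
  have : IsAddCyclic G := isAddCyclic_of_prime_card hc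
  let e : G ≃+ ZMod 163 := (zmodAddCyclicAddEquiv (G := G) ‹_›).symm.trans
    (ZMod.ringEquivCongr hc).toAddEquiv
  refine nine_aux (A.map e.toEquiv.toEmbedding) ⟨?_, ?_, ?_, ?_⟩
  · simpa using h.zero
  · intro a ha
    simp only [Finset.mem_map_equiv] at ha ⊢
    have := h.neg _ ha
    simpa using this
  · simp [h.card]
  · intro M _ f
    have := h.star M (fun g => f (e g))
    simp only [Finset.sum_map]
    rw [← Equiv.sum_comp e.toEquiv]
    simpa using this

open AddMonoidAlgebra in
noncomputable def Ael {G : Type} [AddCommGroup G] (A : Finset G) (k : ℕ) :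
    AddMonoidAlgebra ℤ G := ∑ a ∈ A, single (k • a) (1 : ℤ)

noncomputable def Gs (G : Type) [AddCommGroup G] [Fintype G] : AddMonoidAlgebra ℤ G :=
  ∑ g : G, AddMonoidAlgebra.single g (1 : ℤ)

section
set_option linter.unusedSectionVars false
open AddMonoidAlgebra
variable {G : Type} [AddCommGroup G] [Fintype G] [DecidableEq G]

theorem coeff_conv (x y : AddMonoidAlgebra ℤ G) (g : G) :
    (x * y).coeff g = ∑ h, x.coeff h * y.coeff (g - h) := by
  rw [coeff_mul_apply_left, Finsupp.sum_fintype]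
  · simp [sub_eq_neg_add]
  · simp

theorem sum_coeff_mul (x y : AddMonoidAlgebra ℤ G) :
    ∑ g, (x * y).coeff g = (∑ g, x.coeff g) * ∑ g, y.coeff g := by
  simp_rw [coeff_conv]
  rw [Finset.sum_comm, Finset.sum_mul]
  refine Finset.sum_congr rfl fun h _ => ?_
  rw [← Finset.mul_sum]
  congr 1
  exact (Equiv.subRight h).sum_comp (fun g => y.coeff g)

theorem Gs_coeff (g : G) : (Gs G).coeff g = 1 := by
  simp [Gs, coeff_sum, Finsupp.finsetSum_apply, Finsupp.single_apply]

theorem Gs_mul (x : AddMonoidAlgebra ℤ G) :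
    Gs G * x = ((∑ g, x.coeff g : ℤ) : AddMonoidAlgebra ℤ G) * Gs G := by
  have : ((∑ g, x.coeff g : ℤ) : AddMonoidAlgebra ℤ G) * Gs G = (∑ g, x.coeff g : ℤ) • Gs G := by
    rw [zsmul_eq_mul]
  rw [this]
  ext g
  rw [coeff_conv]
  simp only [coeff_smul, Finsupp.smul_apply, Gs_coeff, one_mul, smul_eq_mul, mul_one]
  exact (Equiv.subLeft g).sum_comp (fun g => x.coeff g)

theorem coeff_intmul (c : ℤ) (x : AddMonoidAlgebra ℤ G) (g : G) :
    ((c : AddMonoidAlgebra ℤ G) * x).coeff g = c * x.coeff g := by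
  rw [← zsmul_eq_mul, coeff_smul, Finsupp.smul_apply, smul_eq_mul]

theorem coeff_int (c : ℤ) (g : G) :
    (c : AddMonoidAlgebra ℤ G).coeff g = if g = 0 then c else 0 := by
  rw [AddMonoidAlgebra.intCast_def]
  simp [Finsupp.single_apply, eq_comm]

theorem Ael_mul (A : Finset G) (k l : ℕ) :
    Ael A k * Ael A l = ∑ a ∈ A, ∑ b ∈ A, single (k • a + l • b) (1 : ℤ) := by
  simp [Ael, Finset.sum_mul_sum, single_mul_single]

theorem Ael_sq {n : ℕ} {A : Finset G} (h : NiceSet n G A) (k : ℕ)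
    (hk : (Nat.card G).Coprime k) :
    Ael A k * Ael A k = 2 * Gs G + Ael A (2 * k) + ((2 * (n:ℤ) - 2 : ℤ) : AddMonoidAlgebra ℤ G) := by
  have := h.star (AddMonoidAlgebra ℤ G) (fun g => single (k • g) (1 : ℤ))
  rw [Ael_mul]
  simp only [smul_add] at this
  rw [this]
  have e : ∑ g : G, single (k • g) (1:ℤ) = Gs G := by
    exact (nsmulCoprime hk).sum_comp (fun g => single g (1:ℤ))
  rw [e]
  congr 1
  · congr 1
    · rw [zsmul_eq_mul]; simp
    · simp only [Ael]
      refine Finset.sum_congr rfl fun a _ => ?_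
      rw [smul_smul, mul_comm]
  · rw [zsmul_eq_mul, smul_zero, ← one_def, mul_one]

theorem Ael_cube (A : Finset G) : ∃ W, Ael A 1 ^ 3 = Ael A 3 + 3 * W := by
  classical
  induction A using Finset.induction_on with
  | empty => exact ⟨0, by simp [Ael]⟩
  | insert a s ha ih =>
    obtain ⟨W, hW⟩ := ih
    have h1 : Ael (insert a s) 1 = single (1 • a) 1 + Ael s 1 := by
      simp [Ael, Finset.sum_insert ha]
    have h3 : Ael (insert a s) 3 = single (3 • a) 1 + Ael s 3 := by
      simp [Ael, Finset.sum_insert ha]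
    have h4 : (single (1 • a) (1:ℤ))^3 = single (3 • a) 1 := by
      rw [single_pow]; simp
    refine ⟨W + single (1 • a) 1 ^ 2 * Ael s 1 + single (1 • a) 1 * Ael s 1 ^ 2, ?_⟩
    rw [h1, h3, ← h4]
    linear_combination hW

theorem Ael_coeff (A : Finset G) (k : ℕ) (hk : (Nat.card G).Coprime k) (g : G) :
    (Ael A k).coeff (k • g) = if g ∈ A then 1 else 0 := by
  have hinj : ∀ a b : G, k • a = k • b ↔ a = b := fun a b => (nsmulCoprime hk).apply_eq_iff_eq
  simp [Ael, coeff_sum, Finsupp.finsetSum_apply, Finsupp.single_apply, hinj]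

theorem Ael_coeff_mul (A : Finset G) (k i : ℕ) (hk : (Nat.card G).Coprime k) (g : G) :
    (Ael A (k * i)).coeff (k • g) = (Ael A i).coeff g := by
  have hinj : ∀ a b : G, k • a = k • b ↔ a = b := fun a b => (nsmulCoprime hk).apply_eq_iff_eq
  simp [Ael, coeff_sum, Finsupp.finsetSum_apply, Finsupp.single_apply, mul_smul, hinj]

theorem Ael_conv_scale (A : Finset G) (k i j : ℕ) (hk : (Nat.card G).Coprime k) (g : G) :
    (Ael A (k * i) * Ael A (k * j)).coeff (k • g) = (Ael A i * Ael A j).coeff g := by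
  rw [coeff_conv, coeff_conv]
  rw [← (nsmulCoprime hk).sum_comp]
  refine Finset.sum_congr rfl fun h _ => ?_
  rw [nsmulCoprime_apply, ← smul_sub, Ael_coeff_mul _ _ _ hk, Ael_coeff_mul _ _ _ hk]

theorem Ael_sum {n : ℕ} {A : Finset G} (h : NiceSet n G A) (k : ℕ) :
    ∑ g, (Ael A k).coeff g = 2 * n + 1 := by
  simp only [Ael, coeff_sum, Finsupp.finsetSum_apply, coeff_single]
  rw [Finset.sum_comm]
  simp [Finsupp.single_apply, h.card]

theorem Ael_mem (A : Finset G) (k : ℕ) (hk : (Nat.card G).Coprime k) (g : G) :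
    (Ael A k).coeff g = 0 ∨ (Ael A k).coeff g = 1 := by
  obtain ⟨x, rfl⟩ := (nsmulCoprime hk).surjective g
  rw [nsmulCoprime_apply, Ael_coeff _ _ hk]
  split_ifs <;> simp

theorem Ael_neg {n : ℕ} {A : Finset G} (h : NiceSet n G A) (k : ℕ) (g : G) :
    (Ael A k).coeff (-g) = (Ael A k).coeff g := by
  simp only [Ael, coeff_sum, Finsupp.finsetSum_apply, coeff_single, Finsupp.single_apply]
  refine Finset.sum_nbij' (fun a => -a) (fun a => -a) (fun a => h.neg a) (fun a => h.neg a)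
    (by simp) (by simp) ?_
  intro a _
  simp only [smul_neg, neg_eq_iff_eq_neg]

theorem conv_neg (x y : AddMonoidAlgebra ℤ G) (hx : ∀ g, x.coeff (-g) = x.coeff g)
    (hy : ∀ g, y.coeff (-g) = y.coeff g) (g : G) :
    (x * y).coeff (-g) = (x * y).coeff g := by
  rw [coeff_conv, coeff_conv, ← Equiv.sum_comp (Equiv.neg G)]
  refine Finset.sum_congr rfl fun h _ => ?_
  rw [Equiv.neg_apply, hx, ← hy (g - h)]
  congr 2; abel

theorem conv_zero (x y : AddMonoidAlgebra ℤ G)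
    (hy : ∀ g, y.coeff (-g) = y.coeff g) :
    (x * y).coeff 0 = ∑ g, x.coeff g * y.coeff g := by
  rw [coeff_conv]
  refine Finset.sum_congr rfl fun h _ => ?_
  rw [zero_sub, hy]
end

section extraction

def sgn (b : Bool) : ℤ := if b then 1 else -1

def vec1 {n : ℕ} (x : Fin n × Bool) : Fin n → ℤ := Pi.single x.1 (sgn x.2)

abbrev IdxT (n : ℕ) : Type :=
  Unit ⊕ (Fin n × Bool) ⊕ ({p : Fin n × Fin n // p.1 < p.2} × Bool × Bool)

def vecI {n : ℕ} : IdxT n → Fin n → ℤ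
  | .inl _ => 0
  | .inr (.inl x) => vec1 x
  | .inr (.inr (p, b, c)) => vec1 (p.1.1, b) + vec1 (p.1.2, c)

theorem sgn_cases (b : Bool) : sgn b = 1 ∨ sgn b = -1 := by cases b <;> simp [sgn]

theorem sgn_inj {b c : Bool} (h : sgn b = sgn c) : b = c := by
  revert h; cases b <;> cases c <;> simp [sgn]

theorem vecI_ball {n : ℕ} (x : IdxT n) : vecI x ∈ errBall n := by
  classical
  rcases x with x | x | ⟨⟨⟨i, j⟩, hij⟩, b, c⟩
  · simp [vecI, errBall]
  · refine ⟨fun k => ?_, ?_⟩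
    · have := sgn_cases x.2
      simp only [vecI, vec1, Pi.single_apply]
      split_ifs <;> omega
    · refine le_trans (Finset.card_le_card (t := {x.1}) ?_) (by simp)
      intro k
      simp only [vecI, vec1, Pi.single_apply, Finset.mem_filter, Finset.mem_singleton]
      intro h
      by_contra hc
      simp [hc] at h
  · refine ⟨fun k => ?_, ?_⟩
    · have := sgn_cases b
      have := sgn_cases c
      have hne : i ≠ j := ne_of_lt hij
      simp only [vecI, vec1, Pi.single_apply, Pi.add_apply]
      split_ifs
      · exact absurd (by simp_all) hne
      all_goals omega
    · refine le_trans (Finset.card_le_card (t := {i, j}) ?_) Finset.card_le_two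
      intro k
      simp only [vecI, vec1, Pi.single_apply, Pi.add_apply, Finset.mem_filter, Finset.mem_insert,
        Finset.mem_singleton]
      intro h
      by_contra hc
      push Not at hc
      simp [hc] at h

theorem vecI_surj {n : ℕ} (v : Fin n → ℤ) (hv : v ∈ errBall n) : ∃ x, vecI x = v := by
  obtain ⟨h1, h2⟩ := hv
  have hs : ∀ i, v i ≠ 0 → ∃ b, sgn b = v i := by
    intro i hi
    rcases h1 i with h | h | h
    · exact ⟨false, by simp [sgn, h]⟩
    · exact absurd h hi
    · exact ⟨true, by simp [sgn, h]⟩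
  have hmem : ∀ i, i ∈ Finset.univ.filter (fun i => v i ≠ 0) ↔ v i ≠ 0 := by simp
  generalize Finset.univ.filter (fun i => v i ≠ 0) = S at h2 hmem
  interval_cases hc : S.card
  · rw [Finset.card_eq_zero] at hc
    refine ⟨.inl (), ?_⟩
    funext i
    have := hmem i
    simp [hc] at this
    simp [vecI, this]
  · obtain ⟨i, rfl⟩ := Finset.card_eq_one.1 hc
    obtain ⟨b, hb⟩ := hs i ((hmem i).1 (by simp))
    refine ⟨.inr (.inl (i, b)), ?_⟩
    funext k
    have := hmem k
    simp only [vecI, vec1, Pi.single_apply, hb]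
    split_ifs with hk
    · rw [hk]
    · simp [hk] at this; exact this.symm
  · obtain ⟨i, j, hij, rfl⟩ := Finset.card_eq_two.1 hc
    obtain ⟨b, hb⟩ := hs i ((hmem i).1 (by simp))
    obtain ⟨c, hcc⟩ := hs j ((hmem j).1 (by simp))
    rcases lt_or_gt_of_ne hij with hlt | hlt
    · refine ⟨.inr (.inr (⟨(i, j), hlt⟩, b, c)), ?_⟩
      funext k
      have := hmem k
      simp only [vecI, vec1, Pi.single_apply, Pi.add_apply, hb, hcc]
      split_ifs with hk hk' <;> simp_all
    · refine ⟨.inr (.inr (⟨(j, i), hlt⟩, c, b)), ?_⟩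
      funext k
      have := hmem k
      simp only [vecI, vec1, Pi.single_apply, Pi.add_apply, hb, hcc]
      split_ifs with hk hk' <;> simp_all

theorem vecI_inj {n : ℕ} : Function.Injective (vecI (n := n)) := by
  have hsn : ∀ b, sgn b ≠ 0 := fun b => by rcases sgn_cases b with h | h <;> simp [h]
  have key0 : ∀ x : Fin n × Bool, vec1 x ≠ 0 := by
    intro x h
    have := congrFun h x.1
    simp [vec1, hsn] at this
  have key1 : ∀ (i j : Fin n) (b c : Bool), i < j → vec1 (i, b) + vec1 (j, c) ≠ 0 := by
    intro i j b c hij h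
    have := congrFun h i
    simp [vec1, hsn, Pi.single_apply, ne_of_lt hij] at this
  have key2 : ∀ (x : Fin n × Bool) (i j : Fin n) (b c : Bool), i < j →
      vec1 x ≠ vec1 (i, b) + vec1 (j, c) := by
    rintro ⟨k, d⟩ i j b c hij h
    have h1 := congrFun h i
    have h2 := congrFun h j
    have hne := ne_of_lt hij
    simp only [vec1, Pi.single_apply, Pi.add_apply, hne, hne.symm, if_true, if_false, add_zero,
      zero_add] at h1 h2
    split_ifs at h1 with h3
    · split_ifs at h2 with h4
      · exact hne (h3.trans h4.symm)
      · exact hsn _ h2.symm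
    · exact hsn _ h1.symm
  rintro (x | x | ⟨⟨⟨i, j⟩, hij⟩, b, c⟩) (y | y | ⟨⟨⟨i', j'⟩, hij'⟩, b', c'⟩) h
  · rfl
  · exact absurd h.symm (key0 y)
  · exact absurd h.symm (key1 _ _ _ _ hij')
  · exact absurd h (key0 x)
  · obtain ⟨i, b⟩ := x
    obtain ⟨j, c⟩ := y
    have h1 := congrFun h i
    simp only [vecI, vec1, Pi.single_apply, if_true] at h1
    split_ifs at h1 with h3
    · subst h3; rw [sgn_inj h1]
    · exact absurd h1 (hsn _)
  · exact absurd h (key2 _ _ _ _ _ hij')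
  · exact absurd h (key1 _ _ _ _ hij)
  · exact absurd h.symm (key2 _ _ _ _ _ hij)
  · have h1 := congrFun h i
    have h2 := congrFun h j
    have h3 := congrFun h i'
    have h4 := congrFun h j'
    have e1 := hsn b
    have e2 := hsn c
    have e3 := hsn b'
    have e4 := hsn c'
    simp only at hij hij'
    simp only [vecI, vec1, Pi.single_apply, Pi.add_apply] at h1 h2 h3 h4
    have hii : i = i' ∧ j = j' := by
      clear h
      grind
    obtain ⟨rfl, rfl⟩ := hii
    have hne := ne_of_lt hij
    simp [hne] at h1 
    simp [hne.symm] at h2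
    rw [sgn_inj h1, sgn_inj h2]

theorem sum_sym {n : ℕ} {M : Type} [AddCommGroup M] (F : Fin n → Fin n → M)
    (hF : ∀ i j, F i j = F j i) :
    ∑ i, ∑ j, F i j = (2 : ℤ) • ∑ p : {p : Fin n × Fin n // p.1 < p.2}, F p.1.1 p.1.2
      + ∑ i, F i i := by
  have h1 : ∑ p : {p : Fin n × Fin n // p.1 < p.2}, F p.1.1 p.1.2
      = ∑ i, ∑ j, if i < j then F i j else 0 := by
    rw [← Finset.sum_product', Finset.univ_product_univ, ← Finset.sum_filter]
    exact (Finset.sum_subtype (Finset.univ.filter fun p : Fin n × Fin n => p.1 < p.2) (by simp)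
      (fun p => F p.1 p.2)).symm
  have h2 : ∑ i, ∑ j, (if i < j then F i j else 0) = ∑ i, ∑ j, if j < i then F i j else 0 := by
    rw [Finset.sum_comm]
    refine Finset.sum_congr rfl fun i _ => Finset.sum_congr rfl fun j _ => ?_
    rw [hF]
  have h3 : ∑ i, F i i = ∑ i, ∑ j, if i = j then F i j else 0 := by simp
  rw [h1, two_smul]
  nth_rw 2 [h2]
  rw [h3]
  simp only [← Finset.sum_add_distrib]
  refine Finset.sum_congr rfl fun i _ => Finset.sum_congr rfl fun j _ => ?_
  rcases lt_trichotomy i j with h | h | h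
  · simp [h, h.ne, h.not_gt]
  · simp [h]
  · simp [h, h.ne', h.not_gt]

theorem extract (n : ℕ) (L : AddSubgroup (Fin n → ℤ)) (hL : IsLatticeTiling n (errBall n) L) :
    ∃ (G : Type) (_ : AddCommGroup G) (_ : Fintype G) (_ : DecidableEq G) (A : Finset G),
      NiceSet n G A := by
  classical
  let G := (Fin n → ℤ) ⧸ L
  let π : (Fin n → ℤ) →+ G := QuotientAddGroup.mk' L
  have hbij : Function.Bijective (fun x : IdxT n => π (vecI x)) := by
    constructor
    · intro x y hxy
      apply vecI_inj
      have hm : - vecI x + vecI y ∈ L := QuotientAddGroup.eq.1 hxy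
      obtain ⟨p, hp, hu⟩ := hL (vecI y)
      have e1 := hu (vecI y, 0) ⟨vecI_ball y, L.zero_mem, by simp⟩
      have e2 := hu (vecI x, - vecI x + vecI y) ⟨vecI_ball x, hm, by simp⟩
      have := e2.trans e1.symm
      exact congrArg Prod.fst this
    · intro g
      obtain ⟨w, rfl⟩ := QuotientAddGroup.mk'_surjective L g
      obtain ⟨p, ⟨hp1, hp2, hp3⟩, hu⟩ := hL w
      obtain ⟨x, hx⟩ := vecI_surj p.1 hp1
      refine ⟨x, ?_⟩
      simp only [hx]
      refine QuotientAddGroup.eq.2 ?_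
      rw [hp3]; simpa using hp2
  let _ : Fintype G := Fintype.ofBijective _ hbij
  let s : Fin n → G := fun i => π (vec1 (i, true))
  have hs' : ∀ i, π (vec1 (i, false)) = - s i := by
    intro i
    rw [← map_neg]
    congr 1
    simp [vec1, sgn, Pi.single_neg]
  have hsumG : ∀ (M : Type) [AddCommGroup M] (f : G → M), ∑ g, f g =
      f 0 + (∑ i, (f (s i) + f (- s i)) + ∑ p : {p : Fin n × Fin n // p.1 < p.2},
        (f (s p.1.1 + s p.1.2) + f (s p.1.1 - s p.1.2) +
        (f (- s p.1.1 + s p.1.2) + f (- s p.1.1 - s p.1.2)))) := by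
    intro M _ f
    rw [← hbij.sum_comp]
    simp [Fintype.sum_sum_type, Fintype.sum_prod_type, vecI, hs', s, sub_eq_add_neg]
  let τ : Option (Fin n × Bool) → G := fun x => x.elim 0 (fun y => π (vec1 y))
  have hτ : Function.Injective τ := by
    rintro (_ | x) (_ | y) h
    · rfl
    · have := @hbij.1 (.inl ()) (.inr (.inl y)) (by simpa [vecI, τ] using h)
      simp at this
    · have := @hbij.1 (.inr (.inl x)) (.inl ()) (by simpa [vecI, τ] using h)
      simp at this
    · have := @hbij.1 (.inr (.inl x)) (.inr (.inl y)) (by simpa [vecI, τ] using h)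
      simpa using this
  let A : Finset G := Finset.univ.image τ
  have hsumA : ∀ (M : Type) [AddCommGroup M] (f : G → M), ∑ a ∈ A, f a =
      f 0 + ∑ i, (f (s i) + f (- s i)) := by
    intro M _ f
    rw [Finset.sum_image (fun _ _ _ _ h => hτ h)]
    simp [Fintype.sum_option, Fintype.sum_prod_type, τ, hs', s]
  refine ⟨G, inferInstance, inferInstance, inferInstance, A, ?_, ?_, ?_, ?_⟩
  · exact Finset.mem_image.2 ⟨none, by simp, rfl⟩
  · intro a ha
    obtain ⟨x, -, rfl⟩ := Finset.mem_image.1 ha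
    rcases x with _ | ⟨i, _ | _⟩
    · simpa [τ] using ha
    · exact Finset.mem_image.2 ⟨some (i, true), by simp, by simp only [τ, Option.elim, hs', s]; exact (neg_neg _).symm⟩
    · exact Finset.mem_image.2 ⟨some (i, false), by simp, by simp [τ, hs', s]⟩
  · rw [Finset.card_image_of_injective _ hτ]
    simp; ring
  · intro M _ f
    simp only [hsumA]
    rw [hsumG]
    have hsy := sum_sym (fun i j => f (s i + s j) + f (s i - s j) + (f (- s i + s j) + f (- s i - s j)))
      (by
        intro i j
        rw [add_comm (s j) (s i), show s j - s i = - s i + s j by abel,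
          show - s j + s i = s i - s j by abel, show - s j - s i = - s i - s j by abel]
        abel)
    have e1 : ∑ i, ((f (s i + 0) + ∑ j, (f (s i + s j) + f (s i + - s j))) +
        (f (- s i + 0) + ∑ j, (f (- s i + s j) + f (- s i + - s j)))) =
        ∑ i, (f (s i) + f (- s i)) + ∑ i, ∑ j,
          (f (s i + s j) + f (s i - s j) + (f (- s i + s j) + f (- s i - s j))) := by
      simp only [← sub_eq_add_neg, add_zero, Finset.sum_add_distrib]
      abel
    rw [e1, hsy]
    have e2 : ∑ i, (f (s i + s i) + f (s i - s i) + (f (- s i + s i) + f (- s i - s i))) =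
        ∑ i, (f (2 • s i) + f (2 • (- s i))) + (2 * (n : ℤ)) • f 0 := by
      have : ∀ i, (f (s i + s i) + f (s i - s i) + (f (- s i + s i) + f (- s i - s i))) =
          (f (2 • s i) + f (2 • (- s i))) + (2:ℤ) • f 0 := by
        intro i
        rw [two_smul, two_smul, two_smul, sub_self, neg_add_cancel, sub_eq_add_neg (- s i)]
        abel
      simp only [this]
      rw [Finset.sum_add_distrib]
      congr 1
      simp [mul_comm, mul_smul]
    rw [e2]
    simp only [smul_zero, zero_add, sub_smul, smul_add]
    abel

end extraction

section mainpart
set_option linter.unusedSectionVars false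
open AddMonoidAlgebra
variable {G : Type} [AddCommGroup G] [Fintype G] [DecidableEq G]

theorem uu_nonneg (u : ℤ) : 0 ≤ u * (u - 1) := by
  rcases le_or_gt u 0 with h | h
  · nlinarith
  · nlinarith

theorem phase1_pt (n a1 a3 b w t : ℤ) (hn : n = 3 * t) (h1 : a1 = 0 ∨ a1 = 1)
    (h3 : a3 = 0 ∨ a3 = 1) (hb : b = a3 + 3 * w - 2 * (2 * n + 1) - (2 * n - 2) * a1) :
    0 ≤ (b - 1) * (b - 4) + 2 * a3 + 2 * a1 - 4 * (a1 * a3) := by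
  rcases h1 with rfl | rfl <;> rcases h3 with rfl | rfl
  · obtain ⟨u, rfl⟩ : ∃ u, b = 3 * u + 1 := ⟨w - 4 * t - 1, by subst hn; linarith⟩
    nlinarith [uu_nonneg u]
  · obtain ⟨u, rfl⟩ : ∃ u, b = 3 * u + 2 := ⟨w - 4 * t - 1, by subst hn; linarith⟩
    have := uu_nonneg u
    have := uu_nonneg (-u)
    nlinarith
  · obtain ⟨u, rfl⟩ : ∃ u, b = 3 * u := ⟨w - 6 * t, by subst hn; linarith⟩
    have := uu_nonneg u
    have := uu_nonneg (u - 1)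
    nlinarith
  · obtain ⟨u, rfl⟩ : ∃ u, b = 3 * u + 1 := ⟨w - 6 * t, by subst hn; linarith⟩
    nlinarith [uu_nonneg u]

theorem cop {n : ℕ} {A : Finset G} (h : NiceSet n G A) (h3 : 3 ∣ n) :
    (Nat.card G).Coprime 2 ∧ (Nat.card G).Coprime 3 := by
  have hN : Nat.card G = 2 * n ^ 2 + 1 := by
    have := h.cardG
    rw [Nat.card_eq_fintype_card]; exact_mod_cast this
  rw [hN]
  obtain ⟨t, rfl⟩ := h3
  constructor
  · rw [Nat.coprime_comm, Nat.prime_two.coprime_iff_not_dvd]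
    omega
  · rw [Nat.coprime_comm, Nat.prime_three.coprime_iff_not_dvd]
    rw [show 2 * (3 * t) ^ 2 + 1 = 3 * (6 * t ^ 2) + 1 by ring]
    omega

theorem phase1 {n : ℕ} {A : Finset G} (h : NiceSet n G A) (h3 : 3 ∣ n)
    (c2 : (Nat.card G).Coprime 2) (c3 : (Nat.card G).Coprime 3) (W : AddMonoidAlgebra ℤ G)
    (hB : Ael A 1 * Ael A 2 = Ael A 3 + ((3 : ℤ) : AddMonoidAlgebra ℤ G) * W
      + ((-2 * (2 * n + 1) : ℤ) : AddMonoidAlgebra ℤ G) * Gs G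
      + ((-(2 * n - 2) : ℤ) : AddMonoidAlgebra ℤ G) * Ael A 1)
    (S1 : Ael A 1 * Ael A 1 = 2 * Gs G + Ael A 2 + ((2 * (n:ℤ) - 2 : ℤ) : AddMonoidAlgebra ℤ G))
    (S2 : Ael A 2 * Ael A 2 = 2 * Gs G + Ael A 4 + ((2 * (n:ℤ) - 2 : ℤ) : AddMonoidAlgebra ℤ G)) 
    (hG : ∀ k, Gs G * Ael A k = ((2 * n + 1 : ℤ) : AddMonoidAlgebra ℤ G) * Gs G)
    (hGG : Gs G * Gs G = ((2 * n ^ 2 + 1 : ℤ) : AddMonoidAlgebra ℤ G) * Gs G) 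
    (hone : ∀ k, (Nat.card G).Coprime k → (Ael A k).coeff 0 = 1) :
    (Ael A 1 * Ael A 3).coeff 0 = 1 := by
  have c1 : (Nat.card G).Coprime 1 := Nat.coprime_one_right _
  have c4 : (Nat.card G).Coprime 4 := Nat.Coprime.pow_right 2 c2
  obtain ⟨t, ht⟩ := h3
  have ht' : (n : ℤ) = 3 * t := by exact_mod_cast ht
  have hb : ∀ g, (Ael A 1 * Ael A 2).coeff g = (Ael A 3).coeff g + 3 * W.coeff g
      - 2 * (2 * n + 1) - (2 * n - 2) * (Ael A 1).coeff g := by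
    intro g
    rw [hB]
    simp only [coeff_add, Finsupp.add_apply, coeff_intmul, Gs_coeff]
    ring
  have hBB : (Ael A 1 * Ael A 2) * (Ael A 1 * Ael A 2) =
      ((8 * n ^ 2 + 16 * n : ℤ) : AddMonoidAlgebra ℤ G) * Gs G + Ael A 2 * Ael A 4
      + ((2 * n - 2 : ℤ) : AddMonoidAlgebra ℤ G) * (Ael A 2 + Ael A 4)
      + (((2 * n - 2) ^ 2 : ℤ) : AddMonoidAlgebra ℤ G) := by
    have g2 := hG 2
    have g4 := hG 4
    push_cast at *
    linear_combination (Ael A 2 * Ael A 2) * S1 + (2 * Gs G + Ael A 2 + (2 * n - 2)) * S2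
      + 4 * hGG + 2 * g2 + 2 * g4
  have hsymm : ∀ g, (Ael A 1 * Ael A 2).coeff (-g) = (Ael A 1 * Ael A 2).coeff g :=
    conv_neg _ _ (Ael_neg h 1) (Ael_neg h 2)
  have hsc : (Ael A 2 * Ael A 4).coeff 0 = (Ael A 1 * Ael A 2).coeff 0 := by
    have := Ael_conv_scale A 2 1 2 c2 0
    simpa using this
  have hsq : ∑ g, (Ael A 1 * Ael A 2).coeff g * (Ael A 1 * Ael A 2).coeff g
      = 12 * n ^ 2 + 12 * n + (Ael A 1 * Ael A 2).coeff 0 := by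
    rw [← conv_zero _ _ hsymm, hBB]
    simp only [coeff_add, Finsupp.add_apply, coeff_intmul, Gs_coeff, coeff_int, if_true, hsc,
      hone 2 c2, hone 4 c4]
    ring
  have hsum : ∑ g, (Ael A 1 * Ael A 2).coeff g = (2 * n + 1) * (2 * n + 1) := by
    rw [sum_coeff_mul, Ael_sum h, Ael_sum h]
  have hbeta : (Ael A 1 * Ael A 3).coeff 0 = ∑ g, (Ael A 1).coeff g * (Ael A 3).coeff g :=
    conv_zero _ _ (Ael_neg h 3)
  set b : G → ℤ := fun g => (Ael A 1 * Ael A 2).coeff g with hbdef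
  have hnn : ∀ g ∈ Finset.univ, 0 ≤ (b g - 1) * (b g - 4) + 2 * (Ael A 3).coeff g
      + 2 * (Ael A 1).coeff g - 4 * ((Ael A 1).coeff g * (Ael A 3).coeff g) := fun g _ =>
    phase1_pt n _ _ _ _ t ht' (Ael_mem A 1 c1 g) (Ael_mem A 3 c3 g) (hb g)
  have hle := Finset.single_le_sum hnn (Finset.mem_univ 0)
  have hcalc : ∑ g, (b g - 1) * (b g - 4) = -8 * n - 1 + b 0 := by
    have : ∀ g, (b g - 1) * (b g - 4) = b g * b g - 5 * b g + 4 := fun g => by ring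
    simp only [this, Finset.sum_add_distrib, Finset.sum_sub_distrib, ← Finset.mul_sum]
    rw [hsq, hsum]
    simp only [Finset.sum_const, Finset.card_univ, nsmul_eq_mul]
    rw [h.cardG]
    ring
  have heven : (2 : ℤ) ∣ ∑ g, (b g - 1) * (b g - 4) := by
    apply Finset.dvd_sum
    intro g _
    rcases Int.even_or_odd (b g) with ⟨u, hu⟩ | ⟨u, hu⟩
    · exact ⟨(b g - 1) * (u - 2), by rw [hu]; ring⟩
    · exact ⟨u * (b g - 4), by rw [hu]; ring⟩
  rw [hcalc] at heven
  simp only [Finset.sum_add_distrib, Finset.sum_sub_distrib, ← Finset.mul_sum] at hle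
  rw [hcalc, Ael_sum h, Ael_sum h, ← hbeta, hone 1 c1, hone 3 c3] at hle
  have hb0 := hb 0
  rw [hone 1 c1, hone 3 c3] at hb0
  have hbge : 1 ≤ (Ael A 1 * Ael A 3).coeff 0 := by
    rw [hbeta]
    have := Finset.single_le_sum (s := Finset.univ)
      (f := fun g => (Ael A 1).coeff g * (Ael A 3).coeff g) (fun g _ => by
        rcases Ael_mem A 1 c1 g with e | e <;> rcases Ael_mem A 3 c3 g with e' | e' <;>
          simp [e, e']) (Finset.mem_univ 0)
    simpa [hone 1 c1, hone 3 c3] using this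
  change b 0 = _ at hb0
  generalize b 0 = x at *
  generalize (Ael A 1 * Ael A 3).coeff 0 = y at *
  obtain ⟨v, hv⟩ : ∃ v, x = 6 * v + 1 := by
    obtain ⟨r, hr⟩ := heven
    exact ⟨(x - 1) / 6, by omega⟩
  have hv0 : v = 0 := by
    subst hv
    have h6 : 6 * v * (6 * v - 4) ≤ 0 := by nlinarith
    rcases lt_trichotomy v 0 with h7 | h7 | h7
    · nlinarith
    · exact h7
    · nlinarith
  subst hv0
  subst hv
  omega

set_option maxHeartbeats 2000000 in
theorem main_case {n : ℕ} {A : Finset G} (h : NiceSet n G A) (h3 : 3 ∣ n) (hn : 24 ≤ n) :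
    False := by
  obtain ⟨c2, c3⟩ := cop h h3
  have c1 : (Nat.card G).Coprime 1 := Nat.coprime_one_right _
  have c4 : (Nat.card G).Coprime 4 := Nat.Coprime.pow_right 2 c2
  have c6 : (Nat.card G).Coprime 6 := Nat.Coprime.mul_right c2 c3
  have S1 := Ael_sq h 1 c1
  have S2 := Ael_sq h 2 c2
  have S3 := Ael_sq h 3 c3
  norm_num only at S1 S2 S3
  have hG : ∀ k, Gs G * Ael A k = ((2 * n + 1 : ℤ) : AddMonoidAlgebra ℤ G) * Gs G := by
    intro k
    rw [Gs_mul, Ael_sum h]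
  have hGG : Gs G * Gs G = ((2 * n ^ 2 + 1 : ℤ) : AddMonoidAlgebra ℤ G) * Gs G := by
    rw [Gs_mul]
    simp only [Gs_coeff]
    simp only [Finset.sum_const, Finset.card_univ, nsmul_eq_mul, mul_one]
    rw [h.cardG]
  have hone : ∀ k, (Nat.card G).Coprime k → (Ael A k).coeff 0 = 1 := by
    intro k hk
    have := Ael_coeff A k hk 0
    simpa [h.zero] using this
  obtain ⟨W, hW⟩ := Ael_cube A
  have hB : Ael A 1 * Ael A 2 = Ael A 3 + ((3 : ℤ) : AddMonoidAlgebra ℤ G) * W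
      + ((-2 * (2 * n + 1) : ℤ) : AddMonoidAlgebra ℤ G) * Gs G
      + ((-(2 * n - 2) : ℤ) : AddMonoidAlgebra ℤ G) * Ael A 1 := by
    have g1 := hG 1
    push_cast at *
    linear_combination hW - Ael A 1 * S1 - 2 * g1
  have hβ := phase1 h h3 c2 c3 W hB S1 S2 hG hGG hone
  have hD : Ael A 1 * Ael A 3 = ((2 * (2 * n + 1) + 2 + 2 * (2 * n + 1) ^ 2 + 2 * (2 * n - 2) : ℤ)
      : AddMonoidAlgebra ℤ G) * Gs G + Ael A 4
      + ((2 * (2 * n - 2) : ℤ) : AddMonoidAlgebra ℤ G) * Ael A 2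
      + (((2 * n - 2) + (2 * n - 2) ^ 2 : ℤ) : AddMonoidAlgebra ℤ G)
      + ((-3 : ℤ) : AddMonoidAlgebra ℤ G) * (Ael A 1 * W) := by
    have g1 := hG 1
    have g2 := hG 2
    push_cast at *
    linear_combination (-Ael A 1) * hB + Ael A 2 * S1 + S2 + 2 * g2 + 2 * (2 * n + 1) * g1
      + (2 * n - 2) * S1
  have hEE : (Ael A 1 * Ael A 3 + ((-2 : ℤ) : AddMonoidAlgebra ℤ G) * Gs G) *
      (Ael A 1 * Ael A 3 + ((-2 : ℤ) : AddMonoidAlgebra ℤ G) * Gs G) =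
      Ael A 2 * Ael A 6 + ((2 * n - 2 : ℤ) : AddMonoidAlgebra ℤ G) * (Ael A 2 + Ael A 6)
      + (((2 * n - 2) ^ 2 : ℤ) : AddMonoidAlgebra ℤ G) := by
    have g1 := hG 1
    have g2 := hG 2
    have g3 := hG 3
    have g6 := hG 6
    push_cast at *
    linear_combination (Ael A 3 * Ael A 3) * S1 + (2 * Gs G + Ael A 2 + (2 * n - 2)) * S3
      + 8 * hGG + 2 * g2 + 2 * g6 - 4 * Ael A 3 * g1 - 4 * (2 * n + 1) * g3
  set D := Ael A 1 * Ael A 3 with hDdef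
  set E := D + ((-2 : ℤ) : AddMonoidAlgebra ℤ G) * Gs G with hEdef
  have hEc : ∀ g, E.coeff g = D.coeff g - 2 := by
    intro g
    rw [hEdef]
    simp only [coeff_add, Finsupp.add_apply, coeff_intmul, Gs_coeff]
    ring
  have hDsymm : ∀ g, D.coeff (-g) = D.coeff g :=
    conv_neg _ _ (Ael_neg h 1) (Ael_neg h 3)
  have hEsymm : ∀ g, E.coeff (-g) = E.coeff g := fun g => by rw [hEc, hEc, hDsymm]
  have hDsum : ∑ g, D.coeff g = (2 * n + 1) * (2 * n + 1) := by
    rw [hDdef, sum_coeff_mul, Ael_sum h, Ael_sum h]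
  obtain ⟨t, ht⟩ := h3
  have ht' : (n : ℤ) = 3 * t := by exact_mod_cast ht
  let δ : G → ℤ := fun g => if g = 0 then 1 else 0
  have hδ : ∀ g, δ g = 0 ∨ δ g = 1 := fun g => by
    simp only [δ]; split_ifs <;> simp
  have hδsum : ∑ g, δ g = 1 := by simp [δ]
  have hz : ∀ g, ∃ z, D.coeff g = 2 + (Ael A 4).coeff g - (Ael A 2).coeff g - δ g + 3 * z := by
    intro g
    have : D.coeff g = (2 * (2 * n + 1) + 2 + 2 * (2 * n + 1) ^ 2 + 2 * (2 * n - 2))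
      + (Ael A 4).coeff g + (2 * (2 * n - 2)) * (Ael A 2).coeff g
      + ((2 * n - 2) + (2 * n - 2) ^ 2) * δ g - 3 * (Ael A 1 * W).coeff g := by
      rw [hD]
      simp only [coeff_add, Finsupp.add_apply, coeff_intmul, Gs_coeff, coeff_int, δ]
      split_ifs <;> ring
    refine ⟨4 * t + 24 * t ^ 2 + 8 * t + 4 * t + (4 * t - 1) * (Ael A 2).coeff g
      + (2 * t + 12 * t ^ 2 - 8 * t + 1) * δ g - (Ael A 1 * W).coeff g, ?_⟩
    rw [this, ht']
    ring
  choose z hz using hz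
  have ma2 := Ael_mem A 2 c2
  have ma4 := Ael_mem A 4 c4
  have ma1 := Ael_mem A 1 c1
  have ma3 := Ael_mem A 3 c3
  have hnnp : ∀ g k, 0 ≤ (Ael A 1).coeff k * (Ael A 3).coeff (g - k) := by
    intro g k
    rcases ma1 k with e | e <;> rcases ma3 (g - k) with e' | e' <;> simp [e, e']
  have hD0 : ∀ g, 0 ≤ D.coeff g := by
    intro g
    rw [hDdef, coeff_conv]
    exact Finset.sum_nonneg fun k _ => hnnp g k
  have hD1 : ∀ x y : G, x ∈ A → y ∈ A → 1 ≤ D.coeff (x + 3 • y) := by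
    intro x y hx hy
    rw [hDdef, coeff_conv]
    have := Finset.single_le_sum (fun k _ => hnnp (x + 3 • y) k) (Finset.mem_univ x)
    refine le_trans (le_of_eq ?_) this
    have e1 := Ael_coeff A 1 c1 x
    have e3 := Ael_coeff A 3 c3 y
    rw [one_smul, if_pos hx] at e1
    rw [if_pos hy] at e3
    rw [e1, add_sub_cancel_left, e3, one_mul]
  have hmemk : ∀ k, (Nat.card G).Coprime k → ∀ g, (Ael A k).coeff g = 1 →
      ∃ x ∈ A, g = k • x := by
    intro k hk g hg
    obtain ⟨x, rfl⟩ := (nsmulCoprime hk).surjective g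
    rw [nsmulCoprime_apply] at *
    rw [Ael_coeff A k hk] at hg
    refine ⟨x, ?_, rfl⟩
    by_contra hc
    simp [hc] at hg
  have hD2 : ∀ g, (Ael A 2).coeff g = 1 → 1 ≤ D.coeff g := by
    intro g hg
    obtain ⟨x, hx, rfl⟩ := hmemk 2 c2 g hg
    have := hD1 (-x) x (h.neg x hx) hx
    rwa [show -x + 3 • x = 2 • x by abel] at this
  have hD4 : ∀ g, (Ael A 4).coeff g = 1 → 1 ≤ D.coeff g := by
    intro g hg
    obtain ⟨x, hx, rfl⟩ := hmemk 4 c4 g hg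
    have := hD1 x x hx hx
    rwa [show x + 3 • x = 4 • x by abel] at this
  have hz0 : ∀ g, 0 ≤ z g := by
    intro g
    have e1 := hz g
    have e2 := hD0 g
    have e3 := hD2 g
    have e4 := hD4 g
    have e5 := hδ g
    have e6 := ma2 g
    have e7 := ma4 g
    omega
  have hzz : z 0 = 0 := by
    have e1 := hz 0
    rw [hβ, hone 2 c2, hone 4 c4] at e1
    simp only [δ, if_true] at e1
    omega
  have hzsum : 3 * ∑ g, z g = 4 * n := by
    have e : ∑ g, D.coeff g = 2 * (2 * n ^ 2 + 1) + (2 * n + 1) - (2 * n + 1) - 1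
        + 3 * ∑ g, z g := by
      simp only [hz, Finset.sum_add_distrib, Finset.sum_sub_distrib, ← Finset.mul_sum]
      rw [Ael_sum h, Ael_sum h, hδsum]
      simp only [Finset.sum_const, Finset.card_univ, nsmul_eq_mul]
      rw [h.cardG]
      ring
    rw [hDsum] at e
    linarith
  -- c and kappa
  let c : G → ℤ := fun g => (Ael A 4).coeff g - (Ael A 2).coeff g - δ g
  let κ : G → ℤ := fun g => (Ael A 4).coeff g + (Ael A 2).coeff g - δ g
  have hEz : ∀ g, E.coeff g = 3 * z g + c g := fun g => by
    rw [hEc, hz]; simp only [c]; ring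
  have hcκ : ∀ g, -1 ≤ c g ∧ c g ≤ 1 ∧ c g ≤ κ g ∧ -c g ≤ κ g ∧ c g * c g ≤ κ g := by
    intro g
    simp only [c, κ, δ]
    split_ifs with h0
    · rw [h0, hone 2 c2, hone 4 c4]; norm_num
    · rcases ma2 g with e | e <;> rcases ma4 g with e' | e' <;> rw [e, e'] <;> norm_num
  have hκsum : ∑ g, κ g = 4 * n + 1 := by
    simp only [κ, Finset.sum_add_distrib, Finset.sum_sub_distrib]
    rw [Ael_sum h, Ael_sum h, hδsum]; ring
  have hsc : ∀ g, (Ael A 2 * Ael A 6).coeff (2 • g) = D.coeff g := by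
    intro g
    have := Ael_conv_scale A 2 1 3 c2 g
    simpa using this
  have hE2 : ∑ g, E.coeff g * E.coeff g = (2 * n - 1) ^ 2 := by
    rw [← conv_zero _ _ hEsymm, hEE]
    have := hsc 0
    rw [smul_zero, hβ] at this
    simp only [coeff_add, Finsupp.add_apply, coeff_intmul, Gs_coeff, coeff_int, if_true, this,
      hone 2 c2, hone 6 c6]
    ring
  obtain ⟨g, -, hg⟩ := Finset.exists_max_image Finset.univ z ⟨0, Finset.mem_univ 0⟩
  have hm : (n : ℤ) - 4 ≤ 3 * z g := by
    have e : ∑ x, E.coeff x * E.coeff x ≤ ∑ x, ((9 * z g + 6) * z x + κ x) := by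
      refine Finset.sum_le_sum fun x _ => ?_
      rw [hEz]
      obtain ⟨e1, e2, e3, e4, e5⟩ := hcκ x
      have e6 := hg x (Finset.mem_univ x)
      have e7 := hz0 x
      nlinarith [mul_nonneg e7 (sub_nonneg.2 e6), mul_nonneg e7 (sub_nonneg.2 e2)]
    rw [hE2, Finset.sum_add_distrib, ← Finset.mul_sum, hκsum] at e
    have hn' : (24 : ℤ) ≤ n := by exact_mod_cast hn
    have e8 : (9 * z g + 6) * ∑ x, z x = (3 * z g + 2) * (4 * n) := by
      rw [← hzsum]; ring
    rw [e8] at e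
    by_contra hc
    push Not at hc
    nlinarith
  have hg0 : g ≠ 0 := by
    rintro rfl
    rw [hzz] at hm
    omega
  have ha13 : (Ael A 1).coeff g + (Ael A 3).coeff g ≤ 1 := by
    by_contra hc
    have e1 : (Ael A 1).coeff g = 1 := by rcases ma1 g with e | e <;> rcases ma3 g with e' | e' <;> omega
    have e3 : (Ael A 3).coeff g = 1 := by rcases ma1 g with e | e <;> rcases ma3 g with e' | e' <;> omega
    have hb : D.coeff 0 = ∑ g, (Ael A 1).coeff g * (Ael A 3).coeff g :=
      conv_zero _ _ (Ael_neg h 3)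
    have hsub := Finset.sum_le_sum_of_subset_of_nonneg (Finset.subset_univ ({g, 0} : Finset G))
      (f := fun g => (Ael A 1).coeff g * (Ael A 3).coeff g) (fun k _ _ => by
        rcases ma1 k with e | e <;> rcases ma3 k with e' | e' <;> simp [e, e'])
    rw [← hb, hβ, Finset.sum_pair hg0, e1, e3, hone 1 c1, hone 3 c3] at hsub
    norm_num at hsub
  have h2g : (2 : ℕ) • g ≠ 0 := by
    intro hc
    have := (nsmulCoprime c2).injective (a₁ := g) (a₂ := 0) (by simpa using hc)
    exact hg0 this
  have hconv : ∑ k, E.coeff k * E.coeff (2 • g - k) ≤ E.coeff g + 2 * n := by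
    rw [← coeff_conv, hEE]
    have s2 := Ael_coeff_mul A 2 1 c2 g
    have s6 := Ael_coeff_mul A 2 3 c2 g
    norm_num only at s2 s6
    simp only [coeff_add, Finsupp.add_apply, coeff_intmul, coeff_int, if_neg h2g, hsc, s2, s6, hEc]
    have hn' : (24 : ℤ) ≤ n := by exact_mod_cast hn
    nlinarith
  have hF : ∀ k ∈ Finset.univ, 0 ≤ E.coeff k * E.coeff (2 • g - k) + 3 * z k + 3 * z (2 • g - k)
      + κ k := by
    intro k _
    rw [hEz, hEz]
    obtain ⟨e1, e2, e3, e4, -⟩ := hcκ k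
    obtain ⟨f1, f2, -, -, -⟩ := hcκ (2 • g - k)
    have p := hz0 k
    have q := hz0 (2 • g - k)
    have r1 := mul_nonneg p q
    have r2 : 0 ≤ z k * (1 + c (2 • g - k)) := mul_nonneg p (by linarith)
    have r3 : 0 ≤ z (2 • g - k) * (1 + c k) := mul_nonneg q (by linarith)
    have r4 : 0 ≤ c k * c (2 • g - k) + κ k := by
      have : c (2 • g - k) = -1 ∨ c (2 • g - k) = 0 ∨ c (2 • g - k) = 1 := by omega
      rcases this with e | e | e <;> rw [e] <;> linarith
    nlinarith
  have hle := Finset.single_le_sum hF (Finset.mem_univ g)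
  have hshift : ∑ k, z (2 • g - k) = ∑ k, z k := (Equiv.subLeft (2 • g)).sum_comp z
  simp only [Finset.sum_add_distrib, ← Finset.mul_sum] at hle
  rw [hshift, hzsum, hκsum, show 2 • g - g = g by abel] at hle
  obtain ⟨e1, e2, e3, e4, e5⟩ := hcκ g
  have hk0 : 0 ≤ κ g := by nlinarith
  have he : (n : ℤ) - 5 ≤ E.coeff g := by rw [hEz]; linarith
  have hn' : (24 : ℤ) ≤ n := by exact_mod_cast hn
  have hfin : E.coeff g * E.coeff g + 2 * (n - 4) ≤ E.coeff g + 14 * n + 1 := by linarith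
  nlinarith

end mainpart


theorem stmt18 (n : ℕ) (hn : 3 ≤ n) (hmod : n % 15 = 9) :
    ¬ ∃ L : AddSubgroup (Fin n → ℤ), IsLatticeTiling n (errBall n) L := by
  rintro ⟨L, hL⟩
  obtain ⟨G, i1, i2, i3, A, hA⟩ := extract n L hL
  by_cases h9 : n = 9
  · subst h9
    exact nine_case G A hA
  · exact main_case hA (by omega) (by omega)
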